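/- arXiv:2501.19127 — 3 statements merged into one kernel-verified Lean document; each statement's English description precedes it below -/
import Mathlib

section
/- Let I be an ideal of k[[t_1,…,t_d]] such that the quotient k[[t_1,…,t_d]]/I is a finite-dimensional k-vector space, and let I_0 = I ∩ k[t_1,…,t_d] be the preimage of I under the canonical inclusion of the polynomial ring into the power series ring. Then the canonical ring homomorphism k[t_1,…,t_d] → k[[t_1,…,t_d]]/I is surjective with kernel I_0, inducing a ring isomorphism k[t_1,…,t_d]/I_0 ≅ k[[t_1,…,t_d]]/I. -/
open MvPowerSeries in
/-- A variable of a power series ring over a field is nilpotent modulo every ideal whose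
quotient ring is Artinian. -/
theorem MvPowerSeries.exists_X_pow_mem {σ k : Type*} [Field k] (I : Ideal (MvPowerSeries σ k))
    [IsArtinianRing (MvPowerSeries σ k ⧸ I)] (i : σ) :
    ∃ n : ℕ, (X i : MvPowerSeries σ k) ^ n ∈ I := by
  obtain ⟨n, y, hy⟩ := IsArtinian.exists_pow_succ_smul_dvd
    (Ideal.Quotient.mk I (X i)) (1 : MvPowerSeries σ k ⧸ I)
  obtain ⟨g, rfl⟩ := Ideal.Quotient.mk_surjective y
  refine ⟨n, ?_⟩
  have hunit : IsUnit (1 - X i * g : MvPowerSeries σ k) := by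
    simp [isUnit_iff_constantCoeff]
  rw [← Ideal.mul_unit_mem_iff_mem I hunit, ← Ideal.Quotient.eq_zero_iff_mem]
  simp only [smul_eq_mul, mul_one, pow_succ] at hy
  simp only [map_mul, map_sub, map_pow, map_one]
  linear_combination -hy

open MvPowerSeries in
/-- A power series all of whose monomials are divisible by `X i ^ n` for some `i` in a finite
set `s` lies in every ideal containing those powers. -/
theorem MvPowerSeries.mem_of_X_pow_mem {σ R : Type*} [CommRing R]
    {I : Ideal (MvPowerSeries σ R)} {n : ℕ} (s : Finset σ)
    (hI : ∀ i ∈ s, (X i : MvPowerSeries σ R) ^ n ∈ I) (f : MvPowerSeries σ R)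
    (hf : ∀ m : σ →₀ ℕ, (∀ i ∈ s, m i < n) → coeff m f = 0) : f ∈ I := by
  classical
  induction s using Finset.induction_on generalizing f with
  | empty =>
    have : f = 0 := by
      ext m
      simpa using hf m (by simp)
    simp [this]
  | insert a s ha ih =>
    let g : MvPowerSeries σ R := fun m => if m a < n then coeff m f else 0
    have hg (m : σ →₀ ℕ) : coeff m g = if m a < n then coeff m f else 0 := rfl
    have hgI : g ∈ I := by
      refine ih (fun i hi => hI i (Finset.mem_insert_of_mem hi)) g fun m hm => ?_
      rw [hg]
      split_ifs with hma
      · exact hf m (by simpa [hma] using hm)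
      · rfl
    have hdvd : (X a : MvPowerSeries σ R) ^ n ∣ f - g := by
      rw [X_pow_dvd_iff]
      intro m hm
      simp [hg, hm]
    have hfg := I.mem_of_dvd hdvd (hI a (Finset.mem_insert_self a s))
    simpa using I.add_mem hfg hgI

open MvPowerSeries in
/-- Over finitely many variables, polynomials surject onto every Artinian quotient of the power
series ring over a field. -/
theorem MvPowerSeries.quotient_mk_comp_coe_surjective {σ k : Type*} [Finite σ] [Field k]
    (I : Ideal (MvPowerSeries σ k)) [IsArtinianRing (MvPowerSeries σ k ⧸ I)] :
    Function.Surjective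
      ((Ideal.Quotient.mk I).comp (MvPolynomial.coeToMvPowerSeries.ringHom)) := by
  classical
  have := Fintype.ofFinite σ
  choose e he using exists_X_pow_mem I
  let n := Finset.univ.sup e
  have hn (i : σ) : (X i : MvPowerSeries σ k) ^ n ∈ I :=
    I.pow_mem_of_pow_mem (he i) (Finset.le_sup (Finset.mem_univ i))
  intro y
  obtain ⟨f, rfl⟩ := Ideal.Quotient.mk_surjective y
  refine ⟨trunc' k (Finsupp.equivFunOnFinite.symm fun _ => n) f, ?_⟩
  rw [RingHom.comp_apply, eq_comm, Ideal.Quotient.eq]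
  refine mem_of_X_pow_mem Finset.univ (fun i _ => hn i) _ fun m hm => ?_
  have hle : m ≤ Finsupp.equivFunOnFinite.symm fun _ => n :=
    fun i => (hm i (Finset.mem_univ i)).le
  simp [coeff_trunc', hle]

/-- Let `I` be an ideal of `k[[t_1,…,t_d]]` with finite-dimensional quotient, and let
`I_0 = I ∩ k[t_1,…,t_d]` be the preimage of `I` under the canonical inclusion of the
polynomial ring into the power series ring. Then the canonical ring homomorphism
`k[t_1,…,t_d] → k[[t_1,…,t_d]]/I` is surjective with kernel `I_0`, inducing a ring
isomorphism `k[t_1,…,t_d]/I_0 ≅ k[[t_1,…,t_d]]/I`. -/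
theorem polynomial_quotient_of_powerSeries_quotient (k : Type*) [Field k] (d : ℕ)
    (hd : 1 ≤ d) (I : Ideal (MvPowerSeries (Fin d) k))
    (hfin : FiniteDimensional k (MvPowerSeries (Fin d) k ⧸ I)) :
    Function.Surjective
        ((Ideal.Quotient.mk I).comp (MvPolynomial.coeToMvPowerSeries.ringHom)) ∧
      RingHom.ker ((Ideal.Quotient.mk I).comp (MvPolynomial.coeToMvPowerSeries.ringHom))
        = I.comap (MvPolynomial.coeToMvPowerSeries.ringHom) := by
  have : IsArtinianRing (MvPowerSeries (Fin d) k ⧸ I) := IsArtinianRing.of_finite k _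
  exact ⟨MvPowerSeries.quotient_mk_comp_coe_surjective I, by rw [← RingHom.comap_ker, Ideal.mk_ker]⟩
end

section
/- There exists a constant C > 0 (depending only on d) such that the following holds: if S ⊆ ℕ^d is a monoid ideal (i.e. S + ℕ^d ⊆ S) whose complement ℕ^d \ S is finite of cardinality n ≥ 1, then there is a subset G ⊆ S with |G| ≤ C·n^{(d−1)/d} such that S = ⋃_{g ∈ G} (g + ℕ^d). -/
/-- Two elements of an antichain of tuples that agree away from one coordinate are equal. -/
theorem eq_of_isAntichain_of_agree_off {d : ℕ} {A : Set (Fin d → ℕ)} (hA : IsAntichain (· ≤ ·) A)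
    {g h : Fin d → ℕ} (hg : g ∈ A) (hh : h ∈ A) (i : Fin d) (hgh : ∀ j, j ≠ i → g j = h j) :
    g = h := by
  have key : ∀ {a b : Fin d → ℕ}, (∀ j, j ≠ i → a j = b j) → a i ≤ b i → a ≤ b := by
    intro a b hab hi j
    by_cases hj : j = i
    · exact hj ▸ hi
    · exact (hab j hj).le
  rcases le_total (g i) (h i) with hi | hi
  · exact hA.eq hg hh (key hgh hi)
  · exact (hA.eq hh hg (key (fun j hj => (hgh j hj).symm) hi)).symm

/-- An antichain in the cube `[0, m)^d` has at most `m ^ (d - 1)` elements. -/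
theorem card_le_pow_of_isAntichain_of_lt {d : ℕ} (hd : 1 ≤ d) {A : Finset (Fin d → ℕ)}
    (hA : IsAntichain (· ≤ ·) (A : Set (Fin d → ℕ))) {m : ℕ} (hm : ∀ g ∈ A, ∀ i, g i < m) :
    A.card ≤ m ^ (d - 1) := by
  let i : Fin d := ⟨0, hd⟩
  have hcard : Fintype.card {j : Fin d // j ≠ i} = d - 1 := by
    simp [Fintype.card_subtype_compl]
  calc A.card
      ≤ (Fintype.piFinset fun _ : {j : Fin d // j ≠ i} => Finset.range m).card := by
        refine Finset.card_le_card_of_injOn (fun g j => g j) ?_ ?_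
        · intro g hg
          simpa using fun j _ => hm g hg j
        · intro g hg h hh hgh
          exact eq_of_isAntichain_of_agree_off hA hg hh i fun j hj => congrFun hgh ⟨j, hj⟩
    _ = m ^ (d - 1) := by
        simp only [Fintype.card_piFinset, Finset.card_range, Finset.prod_const, Finset.card_univ,
          hcard]

/-- The minimal elements of `S` whose `i`-th coordinate is at least `m` head disjoint
segments of length `m` in the complement of `S`. -/
theorem card_mul_le_of_minimal {d : ℕ} {S : Set (Fin d → ℕ)} (hS : Sᶜ.Finite)
    {A : Finset (Fin d → ℕ)} (hA : ∀ g ∈ A, Minimal (· ∈ S) g) (i : Fin d) {m : ℕ}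
    (hm : ∀ g ∈ A, m ≤ g i) : A.card * m ≤ Nat.card ↥(Sᶜ) := by
  have hanti : IsAntichain (· ≤ ·) (A : Set (Fin d → ℕ)) :=
    (setOfPred_minimal_antichain (· ∈ S)).subset hA
  rw [Nat.card_coe_set_eq, Set.ncard_eq_toFinset_card _ hS]
  calc A.card * m = (A ×ˢ Finset.range m).card := by
        rw [Finset.card_product, Finset.card_range]
    _ ≤ hS.toFinset.card := by
        refine Finset.card_le_card_of_injOn (fun p => Function.update p.1 i p.2) ?_ ?_
        · rintro ⟨g, k⟩ hp
          obtain ⟨hg, hk⟩ : g ∈ A ∧ k < m := by simpa using hp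
          simp only [Set.Finite.coe_toFinset, Set.mem_compl_iff]
          intro hmem
          have hle : Function.update g i k ≤ g :=
            update_le_self_iff.2 (hk.le.trans (hm g hg))
          have hgk : g i ≤ k := by simpa using (hA g hg).2 hmem hle i
          exact absurd ((hm g hg).trans hgk) hk.not_ge
        · rintro ⟨g, k⟩ hp ⟨h, l⟩ hq hgh
          obtain ⟨hg, -⟩ : g ∈ A ∧ k < m := by simpa using hp
          obtain ⟨hh, -⟩ : h ∈ A ∧ l < m := by simpa using hq
          have hkl : k = l := by simpa using congrFun hgh i
          have heq : g = h := eq_of_isAntichain_of_agree_off hanti hg hh i fun j hj => by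
            simpa [hj] using congrFun hgh j
          rw [hkl, heq]

/-- A bound on the number of minimal elements of `S`, with a free cut-off `m` separating the
minimal elements in the cube `[0, m)^d` from the others. -/
theorem card_minimal_mul_le {d : ℕ} (hd : 1 ≤ d) {S : Set (Fin d → ℕ)} (hS : Sᶜ.Finite)
    {G : Finset (Fin d → ℕ)} (hG : ∀ g ∈ G, Minimal (· ∈ S) g) (m : ℕ) :
    G.card * m ≤ d * Nat.card ↥(Sᶜ) + m ^ d := by
  have hcover : G ⊆ (Finset.univ.biUnion fun i => G.filter fun g => m ≤ g i) ∪
      G.filter fun g => ∀ i, g i < m := by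
    intro g hg
    by_cases h : ∀ i, g i < m
    · simp [hg, h]
    · push Not at h
      simp [hg, h]
  have hsmall : (G.filter fun g => ∀ i, g i < m).card ≤ m ^ (d - 1) :=
    card_le_pow_of_isAntichain_of_lt hd
      ((setOfPred_minimal_antichain (· ∈ S)).subset fun g hg => hG g (Finset.mem_filter.1 hg).1)
      fun g hg => (Finset.mem_filter.1 hg).2
  have hlarge : ∀ i, (G.filter fun g => m ≤ g i).card * m ≤ Nat.card ↥(Sᶜ) := fun i =>
    card_mul_le_of_minimal hS (fun g hg => hG g (Finset.mem_filter.1 hg).1) i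
      fun g hg => (Finset.mem_filter.1 hg).2
  calc G.card * m
      ≤ (∑ i, (G.filter fun g => m ≤ g i).card + m ^ (d - 1)) * m := by
        gcongr
        exact (Finset.card_le_card hcover).trans <| (Finset.card_union_le _ _).trans <|
          add_le_add Finset.card_biUnion_le hsmall
    _ = ∑ i, (G.filter fun g => m ≤ g i).card * m + m ^ d := by
        rw [add_mul, Finset.sum_mul, ← pow_succ, Nat.sub_add_cancel hd]
    _ ≤ d * Nat.card ↥(Sᶜ) + m ^ d := by
        gcongr
        simpa using Finset.sum_le_sum fun i (_ : i ∈ Finset.univ) => hlarge i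

/-- There exists a constant `C > 0` (depending only on `d`) such that: if `S ⊆ ℕ^d` is a
monoid ideal whose complement is finite of cardinality `n ≥ 1`, then there is a subset
`G ⊆ S` with `|G| ≤ C·n^{(d−1)/d}` such that `S = ⋃_{g ∈ G} (g + ℕ^d)`. -/
theorem monoid_ideal_generators_bound (d : ℕ) (hd : 1 ≤ d) :
    ∃ C : ℝ, 0 < C ∧ ∀ (S : Set (Fin d → ℕ)), (∀ s ∈ S, ∀ v : Fin d → ℕ, s + v ∈ S) →
      ∀ n : ℕ, 1 ≤ n → Sᶜ.Finite → Nat.card ↥(Sᶜ) = n →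
      ∃ G : Finset (Fin d → ℕ), ↑G ⊆ S ∧
        (G.card : ℝ) ≤ C * (n : ℝ) ^ (((d : ℝ) - 1) / (d : ℝ)) ∧
        S = {x | ∃ g ∈ G, ∃ v : Fin d → ℕ, x = g + v} := by
  have hd0 : (d : ℝ) ≠ 0 := by positivity
  refine ⟨d + 2 ^ d, by positivity, ?_⟩
  intro S hS n hn hfin hcard
  have hGfin : {g | Minimal (· ∈ S) g}.Finite :=
    WellQuasiOrderedLE.finite_of_isAntichain (setOfPred_minimal_antichain (· ∈ S))
  refine ⟨hGfin.toFinset, fun g hg => ?_, ?_, ?_⟩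
  · exact (hGfin.mem_toFinset.1 hg).1
  · set r : ℝ := (n : ℝ) ^ (1 / (d : ℝ)) with hr
    have hn1 : (1 : ℝ) ≤ n := by exact_mod_cast hn
    have hr1 : 1 ≤ r := Real.one_le_rpow hn1 (by positivity)
    have hrd : r ^ d = n := by
      rw [hr, one_div, Real.rpow_inv_natCast_pow (by positivity) (by omega)]
    have hmul : (n : ℝ) ^ (((d : ℝ) - 1) / d) * r = n := by
      rw [hr, ← Real.rpow_add (by positivity), ← add_div, sub_add_cancel, div_self hd0,
        Real.rpow_one]
    have hmle : (⌈r⌉₊ : ℝ) ≤ 2 * r := by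
      linarith [Nat.ceil_lt_add_one (zero_le_one.trans hr1)]
    have hbound : (hGfin.toFinset.card : ℝ) * ⌈r⌉₊ ≤ d * n + (⌈r⌉₊ : ℝ) ^ d := by
      have := card_minimal_mul_le hd hfin (fun g hg => hGfin.mem_toFinset.1 hg) ⌈r⌉₊
      rw [hcard] at this
      exact_mod_cast this
    refine le_of_mul_le_mul_right ?_ (zero_lt_one.trans_le hr1)
    calc (hGfin.toFinset.card : ℝ) * r
        ≤ hGfin.toFinset.card * ⌈r⌉₊ := by gcongr; exact Nat.le_ceil r
      _ ≤ d * n + (⌈r⌉₊ : ℝ) ^ d := hbound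
      _ ≤ d * n + (2 * r) ^ d := by gcongr
      _ = (d + 2 ^ d) * (n : ℝ) ^ (((d : ℝ) - 1) / d) * r := by
        rw [mul_assoc, hmul, mul_pow, hrd, add_mul]
  · ext x
    constructor
    · intro hx
      obtain ⟨g, hgx, hg⟩ := exists_minimal_le_of_wellFoundedLT (· ∈ S) x hx
      exact ⟨g, hGfin.mem_toFinset.2 hg, x - g, (add_tsub_cancel_of_le hgx).symm⟩
    · rintro ⟨g, hg, v, rfl⟩
      exact hS g (hGfin.mem_toFinset.1 hg).1 v
end

section
/- Let k be a field, n ∈ ℕ, and let V be a nonzero k-subspace of the space of homogeneous polynomials of degree n in k[x,y]. Let W = x·V + y·V, a subspace of the space of homogeneous polynomials of degree n+1. Then dim_k W ≥ dim_k V + 1. -/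
open MvPolynomial

/-- In finitely many variables, the homogeneous polynomials of a fixed degree form a
finitely generated module. -/
theorem MvPolynomial.finite_homogeneousSubmodule (σ R : Type*) [Finite σ] [CommSemiring R]
    (n : ℕ) : Module.Finite R (homogeneousSubmodule σ R n) := by
  have hspan : homogeneousSubmodule σ R n =
      Submodule.span R ((fun d ↦ monomial d (1 : R)) '' {d : σ →₀ ℕ | d.degree = n}) := by
    rw [homogeneousSubmodule_eq_finsupp_supported]
    exact AddMonoidAlgebra.supported_eq_span_single R _
  rw [hspan]
  exact Module.Finite.span_of_finite R ((Finsupp.finite_of_degree_eq n).image _)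

/-- The only polynomial divisible by all powers of a variable is zero. -/
theorem MvPolynomial.eq_zero_of_forall_X_pow_dvd {σ R : Type*} [CommRing R] [IsDomain R]
    {i : σ} {p : MvPolynomial σ R} (h : ∀ m : ℕ, X i ^ m ∣ p) : p = 0 := by
  by_contra hp
  obtain ⟨q, hq⟩ := h (p.totalDegree + 1)
  have hq0 : q ≠ 0 := right_ne_zero_of_mul (hq ▸ hp)
  have hdeg := congrArg totalDegree hq
  rw [totalDegree_mul_of_isDomain (pow_ne_zero _ (X_ne_zero i)) hq0, totalDegree_X_pow] at hdeg
  omega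

/-- A space of polynomials `V` with `X j * V ⊆ X i * V` for distinct variables is zero. -/
theorem MvPolynomial.eq_bot_of_map_mulLeft_X_le {σ R : Type*} [CommRing R] [IsDomain R]
    {i j : σ} (hij : i ≠ j) {V : Submodule R (MvPolynomial σ R)}
    (h : V.map (LinearMap.mulLeft R (X j)) ≤ V.map (LinearMap.mulLeft R (X i))) : V = ⊥ := by
  have hdvd (m : ℕ) : ∀ v ∈ V, X i ^ m ∣ v := by
    induction m with
    | zero => simp
    | succ m ih =>
      intro v hv
      obtain ⟨w, hw, hwv⟩ := h (Submodule.mem_map_of_mem hv)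
      simp only [LinearMap.mulLeft_apply] at hwv
      refine X_prime.pow_dvd_of_dvd_mul_left _ (mt X_dvd_X.mp hij) ?_
      rw [← hwv, pow_succ']
      exact mul_dvd_mul_left _ (ih w hw)
  exact (Submodule.eq_bot_iff V).mpr fun v hv ↦
    eq_zero_of_forall_X_pow_dvd fun m ↦ hdvd m v hv


/-- Let `k` be a field, `n ∈ ℕ`, and let `V` be a nonzero `k`-subspace of the space of
homogeneous polynomials of degree `n` in `k[x,y]`. Let `W = x·V + y·V`, a subspace of the
space of homogeneous polynomials of degree `n+1`. Then `dim_k W ≥ dim_k V + 1`. -/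
theorem dim_shift_of_homogeneous_subspace (k : Type*) [Field k] (n : ℕ)
    (V : Submodule k (MvPolynomial (Fin 2) k))
    (hV : V ≤ MvPolynomial.homogeneousSubmodule (Fin 2) k n) (hV0 : V ≠ ⊥) :
    Module.finrank k
        ↥(V.map (LinearMap.mulLeft k (MvPolynomial.X 0 : MvPolynomial (Fin 2) k)) ⊔
          V.map (LinearMap.mulLeft k (MvPolynomial.X 1 : MvPolynomial (Fin 2) k)))
      ≥ Module.finrank k V + 1 := by
  have := finite_homogeneousSubmodule (Fin 2) k n
  have : Module.Finite k V := Submodule.finiteDimensional_of_le hV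
  by_contra! hlt
  have hinj : Function.Injective (LinearMap.mulLeft k (X 0 : MvPolynomial (Fin 2) k)) :=
    mul_right_injective₀ (X_ne_zero 0)
  refine hV0 (eq_bot_of_map_mulLeft_X_le zero_ne_one (le_sup_right.trans_eq
    (Submodule.eq_of_le_of_finrank_le le_sup_left ?_).symm))
  rw [← (Submodule.equivMapOfInjective _ hinj V).finrank_eq]
  exact Nat.lt_succ_iff.mp hlt
end
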